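/- Let γ ∈ [−3,−2), let k ≥ 0 and set m(v) = ⟨v⟩^k, and let θ > 7/2 and θ' > 9/4. Then there exists a constant C > 0 such that for all Schwartz functions f, g, h on ℝ³, the Landau pairing satisfies ⟨Q(f,g), h⟩_{L²(m)} ≤ C ( ‖⟨·⟩^θ f‖_{L²} · ‖g‖_{H¹_*(m)} + ‖⟨·⟩^{θ'} f‖_{H¹} · ‖m g‖_{L²} ) · ‖h‖_{H¹_*(m)}, where ⟨Q(f,g), h⟩_{L²(m)} := −∫_{ℝ³} Σ_j ( Σ_i (a_{ij}*f)(v) ∂_i g(v) − (b_j*f)(v) g(v) ) ∂_j(h m²)(v) dv. -/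

import Mathlib

noncomputable section

open MeasureTheory Real Filter

abbrev V3 := EuclideanSpace ℝ (Fin 3)

/-- Japanese bracket ⟨v⟩ = (1+|v|²)^{1/2}. -/
def jap (v : V3) : ℝ := Real.sqrt (1 + ‖v‖ ^ 2)

/-- Standard Gaussian μ on ℝ³. -/
def gaussM (v : V3) : ℝ := (2 * Real.pi) ^ (-(3 : ℝ) / 2) * Real.exp (-‖v‖ ^ 2 / 2)

/-- Landau kernel matrix a_{ij}(z). -/
def aker (γ : ℝ) (z : V3) (i j : Fin 3) : ℝ :=
  ‖z‖ ^ (γ + 2) * ((if i = j then (1 : ℝ) else 0) - z i * z j / ‖z‖ ^ 2)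

/-- ā_{ij} = a_{ij} * μ. -/
def abar (γ : ℝ) (v : V3) (i j : Fin 3) : ℝ := ∫ w : V3, aker γ (v - w) i j * gaussM w

def bker (γ : ℝ) (z : V3) (i : Fin 3) : ℝ := -2 * ‖z‖ ^ γ * z i

/-- b̄_i = b_i * μ. -/
def bbar (γ : ℝ) (v : V3) (i : Fin 3) : ℝ := ∫ w : V3, bker γ (v - w) i * gaussM w

/-- J_β(v) = ∫ |v−w|^β μ(w) dw. -/
def Jfun (β : ℝ) (v : V3) : ℝ := ∫ w : V3, ‖v - w‖ ^ β * gaussM w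

/-- c̄(v) = −2(γ+3) J_γ(v). -/
def cbar (γ : ℝ) (v : V3) : ℝ := -2 * (γ + 3) * Jfun γ v

/-- ℓ₁(v). -/
def ell1 (γ : ℝ) (v : V3) : ℝ :=
  ∫ w : V3, (1 - ((∑ i, v i * w i) / (‖v‖ * ‖w‖)) ^ 2) * ‖w‖ ^ (γ + 2) * gaussM (v - w)

/-- Squared Euclidean norm of the cross product of two vectors in ℝ³. -/
def crossSq (a b : V3) : ℝ :=
  ∑ i, (crossProduct (R := ℝ) (fun k => a k) (fun k => b k) i) ^ 2

/-- ℓ₂(v). -/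
def ell2 (γ : ℝ) (v : V3) : ℝ :=
  ∫ w : V3,
    (1 - (1 / 2) * crossSq (‖v‖⁻¹ • v) (‖w‖⁻¹ • w)) * ‖w‖ ^ (γ + 2) * gaussM (v - w)

/-- Projection P_v ξ on the direction v. -/
def Pv (v ξ : V3) : V3 := ((∑ i, ξ i * v i) / ‖v‖ ^ 2) • v

/-- Partial derivative in the i-th coordinate direction. -/
def pd (i : Fin 3) (f : V3 → ℝ) : V3 → ℝ := fun v => fderiv ℝ f v (EuclideanSpace.single i 1)

/-- Anisotropic gradient ∇̃f = P_v ∇f + ⟨v⟩ (I − P_v) ∇f. -/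
def anisoGrad (f : V3 → ℝ) (v : V3) : V3 :=
  Pv v (gradient f v) + jap v • (gradient f v - Pv v (gradient f v))

/-- The filter |v| → ∞ on ℝ³. -/
def normAtTop : Filter V3 := Filter.comap (fun v : V3 => ‖v‖) Filter.atTop

/-- Convolution on ℝ³. -/
def conv3 (f g : V3 → ℝ) (v : V3) : ℝ := ∫ w : V3, f (v - w) * g w

/-- The H¹_*(⟨v⟩^k) norm:
‖g‖²_{H¹_*(m)} = ∫ ⟨v⟩^γ (mg)² + ∫ ⟨v⟩^γ |∇̃(mg)|², with m = ⟨v⟩^k. -/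
def H1starNorm (γ k : ℝ) (g : V3 → ℝ) : ℝ :=
  Real.sqrt ((∫ v : V3, jap v ^ γ * (jap v ^ k * g v) ^ 2)
    + ∫ v : V3, jap v ^ γ * ‖anisoGrad (fun w => jap w ^ k * g w) v‖ ^ 2)

/-- The standard H¹(ℝ³) norm. -/
def H1Norm (u : V3 → ℝ) : ℝ :=
  Real.sqrt ((∫ v : V3, u v ^ 2) + ∫ v : V3, ‖gradient u v‖ ^ 2)

/-- The weighted L² norm ‖⟨·⟩^θ f‖_{L²}. -/
def L2wNorm (θ : ℝ) (f : V3 → ℝ) : ℝ := Real.sqrt (∫ v : V3, (jap v ^ θ * f v) ^ 2)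

open scoped RealInnerProductSpace

lemma one_le_jap (v : V3) : 1 ≤ jap v := by
  rw [jap, Real.one_le_sqrt]
  nlinarith [sq_nonneg ‖v‖]

lemma jap_pos (v : V3) : 0 < jap v := lt_of_lt_of_le one_pos (one_le_jap v)

lemma jap_sq (v : V3) : jap v ^ 2 = 1 + ‖v‖ ^ 2 :=
  Real.sq_sqrt (by positivity)

lemma norm_le_jap (v : V3) : ‖v‖ ≤ jap v := by
  apply Real.le_sqrt_of_sq_le
  linarith

lemma jap_add_le (z w : V3) : jap (z + w) ≤ jap z + jap w := by
  have hz := jap_pos z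
  have hw := jap_pos w
  have h1 := norm_add_le z w
  have h2 : ‖z‖ * ‖w‖ ≤ jap z * jap w :=
    mul_le_mul (norm_le_jap z) (norm_le_jap w) (norm_nonneg _) hz.le
  refine abs_le_of_sq_le_sq' ?_ (by positivity) |>.2
  rw [jap_sq, add_sq, jap_sq, jap_sq]
  nlinarith [norm_nonneg (z + w), norm_nonneg z, norm_nonneg w]

lemma jap_le_two_mul_norm {v : V3} (h : 1 ≤ ‖v‖) : jap v ≤ 2 * ‖v‖ := by
  refine abs_le_of_sq_le_sq' ?_ (by positivity) |>.2
  rw [jap_sq]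
  nlinarith

lemma jap_le_two {v : V3} (h : ‖v‖ ≤ 1) : jap v ≤ 2 := by
  refine abs_le_of_sq_le_sq' ?_ (by positivity) |>.2
  rw [jap_sq]
  nlinarith [norm_nonneg v]

lemma jap_rpow_eq (r : ℝ) (v : V3) : jap v ^ r = (1 + ‖v‖ ^ 2) ^ (r / 2) := by
  rw [jap, Real.sqrt_eq_rpow, ← Real.rpow_mul (by positivity)]
  congr 1
  ring

lemma continuous_jap_rpow (r : ℝ) : Continuous fun v : V3 => jap v ^ r := by
  simp_rw [jap_rpow_eq]
  refine Continuous.rpow_const (by fun_prop) fun v => Or.inl (by positivity)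

lemma hasTemperateGrowth_jap_rpow (r : ℝ) :
    Function.HasTemperateGrowth fun v : V3 => jap v ^ r := by
  simp_rw [jap_rpow_eq]
  fun_prop

/-- Multiplication of a Schwartz function by a power of the Japanese bracket. -/
def weighted (r : ℝ) (f : SchwartzMap V3 ℝ) : SchwartzMap V3 ℝ :=
  SchwartzMap.smulLeftCLM ℝ (fun v : V3 => jap v ^ r) f

lemma weighted_apply (r : ℝ) (f : SchwartzMap V3 ℝ) (v : V3) :
    weighted r f v = jap v ^ r * f v :=
  SchwartzMap.smulLeftCLM_apply_apply (hasTemperateGrowth_jap_rpow r) f v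

lemma integrable_jap_rpow_neg {b : ℝ} (hb : 3 < b) :
    Integrable fun v : V3 => jap v ^ (-b) := by
  simp_rw [jap_rpow_eq]
  exact integrable_rpow_neg_one_add_norm_sq (by simpa using hb)

lemma integrable_norm_rpow_mul_jap_rpow {a b : ℝ} (ha : a < 3) (hb : 3 < b) :
    Integrable fun z : V3 => ‖z‖ ^ (-a) * jap z ^ (a - b) := by
  simp_rw [jap_rpow_eq]
  rw [integrable_fun_norm_addHaar volume
      (f := fun y : ℝ => y ^ (-a) * (1 + y ^ 2) ^ ((a - b) / 2)),
    ← Set.Ioo_union_Ici_eq_Ioi (zero_lt_one' ℝ), integrableOn_union,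
    integrableOn_Ici_iff_integrableOn_Ioi]
  have hd : Module.finrank ℝ V3 - 1 = 2 := by simp
  rw [hd]
  have hm : Measurable fun y : ℝ => y ^ 2 • (y ^ (-a) * (1 + y ^ 2) ^ ((a - b) / 2)) := by
    fun_prop
  constructor
  · refine Integrable.mono' ((intervalIntegral.integrableOn_Ioo_rpow_iff (s := 2 - a) one_pos).2
      (by linarith)) hm.aestronglyMeasurable ?_
    refine (ae_restrict_mem measurableSet_Ioo).mono fun y hy => ?_
    have hy0 : 0 < y := hy.1
    rw [Real.norm_of_nonneg (by positivity), show 2 - a = 2 + -a by ring, Real.rpow_add hy0,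
      smul_eq_mul,
      ← mul_assoc]
    norm_cast
    refine mul_le_of_le_one_right (by positivity) ?_
    exact Real.rpow_le_one_of_one_le_of_nonpos (by nlinarith) (by linarith)
  · refine Integrable.mono' (integrableOn_Ioi_rpow_of_lt (a := 2 - b) (by linarith) one_pos)
      hm.aestronglyMeasurable ?_
    refine (ae_restrict_mem measurableSet_Ioi).mono fun y hy => ?_
    have hy0 : 0 < y := one_pos.trans hy
    rw [Real.norm_of_nonneg (by positivity), smul_eq_mul]
    have h1 : (1 + y ^ 2) ^ ((a - b) / 2) ≤ y ^ (a - b) := by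
      calc (1 + y ^ 2) ^ ((a - b) / 2) ≤ (y ^ 2) ^ ((a - b) / 2) :=
            Real.rpow_le_rpow_of_nonpos (by positivity) (by linarith) (by linarith)
        _ = y ^ (a - b) := by
            rw [← Real.rpow_natCast, ← Real.rpow_mul hy0.le]; congr 1; push_cast; ring
    calc y ^ 2 * (y ^ (-a) * (1 + y ^ 2) ^ ((a - b) / 2))
        ≤ y ^ (2 : ℝ) * (y ^ (-a) * y ^ (a - b)) := by norm_cast; gcongr
      _ = y ^ (2 - b) := by rw [← Real.rpow_add hy0, ← Real.rpow_add hy0]; congr 1; ring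

lemma singular_weight_le {a c b : ℝ} (ha : 0 ≤ a) (hc : 0 ≤ c) (hb : a + c ≤ b) (z w : V3) :
    jap (z + w) ^ (a + c) * (‖z‖ ^ (-a) * jap z ^ (-c) * jap w ^ (-b))
      ≤ 4 ^ (a + c) * 2 ^ b * (jap w ^ (-b) + ‖z‖ ^ (-a) * jap z ^ (a - b)) := by
  have hz := jap_pos z
  have hw := jap_pos w
  have hadd := jap_add_le z w
  have hs : 0 ≤ ‖z‖ ^ (-a) := by positivity
  have h2b : (1 : ℝ) ≤ 2 ^ b := Real.one_le_rpow (by norm_num) (by linarith)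
  have hv := jap_pos (z + w)
  have h42 : (4 : ℝ) ^ (a + c) = 2 ^ (a + c) * 2 ^ (a + c) := by
    rw [← Real.mul_rpow (by norm_num) (by norm_num)]; norm_num
  have h2ac : (1 : ℝ) ≤ 2 ^ (a + c) := Real.one_le_rpow (by norm_num) (by linarith)
  rcases lt_or_ge (jap z) (jap w) with hzw | hzw
  · have h1 : jap (z + w) ^ (a + c) ≤ 2 ^ (a + c) * jap w ^ (a + c) := by
      rw [← Real.mul_rpow (by norm_num) hw.le]
      exact Real.rpow_le_rpow hv.le (by linarith) (by linarith)
    have h2 : jap w ^ (a + c) * jap w ^ (-b) ≤ jap z ^ (a + c - b) := by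
      rw [← Real.rpow_add hw, ← sub_eq_add_neg]
      exact Real.rpow_le_rpow_of_nonpos hz hzw.le (by linarith)
    calc jap (z + w) ^ (a + c) * (‖z‖ ^ (-a) * jap z ^ (-c) * jap w ^ (-b))
        ≤ 2 ^ (a + c) * jap w ^ (a + c) * (‖z‖ ^ (-a) * jap z ^ (-c) * jap w ^ (-b)) := by gcongr
      _ = 2 ^ (a + c) * (‖z‖ ^ (-a) * jap z ^ (-c)) * (jap w ^ (a + c) * jap w ^ (-b)) := by ring
      _ ≤ 2 ^ (a + c) * (‖z‖ ^ (-a) * jap z ^ (-c)) * jap z ^ (a + c - b) := by gcongr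
      _ = 2 ^ (a + c) * 1 * (0 + ‖z‖ ^ (-a) * jap z ^ (a - b)) := by
          rw [show a - b = -c + (a + c - b) by ring, Real.rpow_add hz (-c)]; ring
      _ ≤ 4 ^ (a + c) * 2 ^ b * (jap w ^ (-b) + ‖z‖ ^ (-a) * jap z ^ (a - b)) := by
          gcongr
          · norm_num
          · positivity
  rcases lt_or_ge ‖z‖ 1 with h1 | h1
  · have hz2 := jap_le_two h1.le
    have e1 : jap (z + w) ^ (a + c) ≤ 4 ^ (a + c) :=
      Real.rpow_le_rpow hv.le (by linarith) (by linarith)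
    have e2 : jap z ^ (-c) ≤ 1 := Real.rpow_le_one_of_one_le_of_nonpos (one_le_jap z) (by linarith)
    have e3 : jap w ^ (-b) ≤ 1 := Real.rpow_le_one_of_one_le_of_nonpos (one_le_jap w) (by linarith)
    have e4 : 1 ≤ 2 ^ b * jap z ^ (a - b) := by
      have : (2 : ℝ) ^ (a - b) ≤ jap z ^ (a - b) :=
        Real.rpow_le_rpow_of_nonpos hz hz2 (by linarith)
      calc (1 : ℝ) ≤ 2 ^ a := Real.one_le_rpow (by norm_num) ha
        _ = 2 ^ b * 2 ^ (a - b) := by rw [← Real.rpow_add (by norm_num)]; congr 1; ring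
        _ ≤ _ := by gcongr
    calc jap (z + w) ^ (a + c) * (‖z‖ ^ (-a) * jap z ^ (-c) * jap w ^ (-b))
        ≤ 4 ^ (a + c) * (‖z‖ ^ (-a) * 1 * 1) := by gcongr
      _ ≤ 4 ^ (a + c) * (‖z‖ ^ (-a) * (2 ^ b * jap z ^ (a - b))) := by
          rw [mul_one, mul_one]; gcongr; exact le_mul_of_one_le_right hs e4
      _ = 4 ^ (a + c) * 2 ^ b * (0 + ‖z‖ ^ (-a) * jap z ^ (a - b)) := by ring
      _ ≤ _ := by gcongr; positivity
  · have e1 : jap (z + w) ^ (a + c) ≤ 2 ^ (a + c) * jap z ^ (a + c) := by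
      rw [← Real.mul_rpow (by norm_num) hz.le]
      exact Real.rpow_le_rpow hv.le (by linarith) (by linarith)
    have hz0 : 0 < ‖z‖ := by linarith
    have e2 : jap z ^ a * ‖z‖ ^ (-a) ≤ 2 ^ (a + c) := by
      calc jap z ^ a * ‖z‖ ^ (-a) ≤ (2 * ‖z‖) ^ a * ‖z‖ ^ (-a) := by
            gcongr; exact jap_le_two_mul_norm h1
        _ = 2 ^ a := by
            rw [Real.mul_rpow (by norm_num) hz0.le, mul_assoc, ← Real.rpow_add hz0]; simp
        _ ≤ 2 ^ (a + c) := Real.rpow_le_rpow_of_exponent_le (by norm_num) (by linarith)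
    calc jap (z + w) ^ (a + c) * (‖z‖ ^ (-a) * jap z ^ (-c) * jap w ^ (-b))
        ≤ 2 ^ (a + c) * jap z ^ (a + c) * (‖z‖ ^ (-a) * jap z ^ (-c) * jap w ^ (-b)) := by gcongr
      _ = 2 ^ (a + c) * ((jap z ^ (a + c) * jap z ^ (-c)) * ‖z‖ ^ (-a)) * jap w ^ (-b) := by ring
      _ = 2 ^ (a + c) * (jap z ^ a * ‖z‖ ^ (-a)) * jap w ^ (-b) := by
          rw [← Real.rpow_add hz]; simp
      _ ≤ 2 ^ (a + c) * 2 ^ (a + c) * jap w ^ (-b) := by gcongr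
      _ = 4 ^ (a + c) * 1 * (jap w ^ (-b) + 0) := by rw [h42]; ring
      _ ≤ _ := by gcongr; positivity

lemma exists_integral_singular_weight_le {a c b : ℝ} (ha : 0 ≤ a) (ha3 : a < 3) (hc : 0 ≤ c)
    (hb3 : 3 < b) (hb : a + c ≤ b) :
    ∃ C > 0, ∀ v : V3,
      Integrable (fun w : V3 => ‖v - w‖ ^ (-a) * jap (v - w) ^ (-c) * jap w ^ (-b)) ∧
      ∫ w : V3, ‖v - w‖ ^ (-a) * jap (v - w) ^ (-c) * jap w ^ (-b) ≤ C * jap v ^ (-(a + c)) := by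
  have i1 := integrable_jap_rpow_neg hb3
  have i2 := integrable_norm_rpow_mul_jap_rpow ha3 hb3
  set K : ℝ := 4 ^ (a + c) * 2 ^ b
  set I1 := ∫ w : V3, jap w ^ (-b)
  set I2 := ∫ z : V3, ‖z‖ ^ (-a) * jap z ^ (a - b)
  have hI1 : 0 ≤ I1 := integral_nonneg fun w => Real.rpow_nonneg (jap_pos w).le _
  have hI2 : 0 ≤ I2 := integral_nonneg fun w =>
    mul_nonneg (by positivity) (Real.rpow_nonneg (jap_pos w).le _)
  have hK : 0 < K := by positivity
  refine ⟨K * (I1 + I2) + 1, by positivity, fun v => ?_⟩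
  have hv := jap_pos v
  have ib : Integrable fun w : V3 => jap v ^ (-(a + c)) *
      (K * (jap w ^ (-b) + ‖v - w‖ ^ (-a) * jap (v - w) ^ (a - b))) :=
    ((i1.add (i2.comp_sub_left v)).const_mul K).const_mul _
  have hle : ∀ w : V3, ‖v - w‖ ^ (-a) * jap (v - w) ^ (-c) * jap w ^ (-b) ≤
      jap v ^ (-(a + c)) * (K * (jap w ^ (-b) + ‖v - w‖ ^ (-a) * jap (v - w) ^ (a - b))) := by
    intro w
    have h := singular_weight_le ha hc hb (v - w) w
    rw [sub_add_cancel] at h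
    rw [Real.rpow_neg hv.le, ← div_eq_inv_mul, le_div_iff₀' (by positivity)]
    exact h
  have hnn : ∀ w : V3, 0 ≤ ‖v - w‖ ^ (-a) * jap (v - w) ^ (-c) * jap w ^ (-b) := fun w => by
    have := jap_pos w
    have := jap_pos (v - w)
    positivity
  have hi : Integrable fun w : V3 => ‖v - w‖ ^ (-a) * jap (v - w) ^ (-c) * jap w ^ (-b) := by
    refine Integrable.mono' ib ?_ (.of_forall fun w => ?_)
    · refine (Measurable.mul (Measurable.mul (by fun_prop) ?_) ?_).aestronglyMeasurable
      · exact (continuous_jap_rpow (-c)).measurable.comp (by fun_prop)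
      · exact (continuous_jap_rpow (-b)).measurable
    · rw [Real.norm_of_nonneg (hnn w)]
      exact hle w
  refine ⟨hi, (integral_mono hi ib hle).trans ?_⟩
  rw [integral_const_mul, integral_const_mul, integral_add i1 (i2.comp_sub_left v),
    integral_sub_left_eq_self (fun z : V3 => ‖z‖ ^ (-a) * jap z ^ (a - b)) volume v, mul_comm]
  gcongr
  linarith

/-- Cauchy–Schwarz inequality for real-valued square-integrable functions. -/
lemma integral_abs_mul_le_sqrt {α : Type*} [MeasurableSpace α] {μ : Measure α} {f g : α → ℝ}
    (hf : MemLp f 2 μ) (hg : MemLp g 2 μ) :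
    ∫ x, |f x| * |g x| ∂μ ≤ √(∫ x, f x ^ 2 ∂μ) * √(∫ x, g x ^ 2 ∂μ) := by
  have h := integral_mul_norm_le_Lp_mul_Lq (p := 2) (q := 2) (f := f) (g := g) (μ := μ)
    ⟨by norm_num, by norm_num, by norm_num⟩ (by simpa using hf) (by simpa using hg)
  simpa [Real.sqrt_eq_rpow] using h

lemma sum_mul_eq_inner (x y : V3) : ∑ i, x i * y i = ⟪y, x⟫ := by
  simp [PiLp.inner_apply]

lemma Pv_eq (v ξ : V3) : Pv v ξ = (⟪v, ξ⟫ / ‖v‖ ^ 2) • v := by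
  rw [Pv, sum_mul_eq_inner]

lemma inner_sub_Pv (z ξ η : V3) :
    ⟪ξ - Pv z ξ, η - Pv z η⟫ = ⟪ξ, η⟫ - ⟪z, ξ⟫ * ⟪z, η⟫ / ‖z‖ ^ 2 := by
  simp only [Pv_eq, inner_sub_left, inner_sub_right, real_inner_smul_left, real_inner_smul_right,
    real_inner_self_eq_norm_sq, real_inner_comm z]
  rcases eq_or_ne ‖z‖ 0 with h | h
  · simp [h]
  · field_simp
    ring

lemma norm_sub_Pv_le (z ξ : V3) : ‖ξ - Pv z ξ‖ ≤ ‖ξ‖ := by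
  refine abs_le_of_sq_le_sq' ?_ (by positivity) |>.2
  rw [← real_inner_self_eq_norm_sq, inner_sub_Pv, real_inner_self_eq_norm_sq]
  have : 0 ≤ ⟪z, ξ⟫ * ⟪z, ξ⟫ / ‖z‖ ^ 2 := div_nonneg (mul_self_nonneg _) (by positivity)
  linarith

lemma Pv_self (v : V3) : Pv v v = v := by
  rw [Pv_eq, real_inner_self_eq_norm_sq]
  rcases eq_or_ne v 0 with h | h
  · simp [h]
  · rw [div_self (by simpa using h), one_smul]

lemma Pv_add (v ξ η : V3) : Pv v (ξ + η) = Pv v ξ + Pv v η := by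
  simp only [Pv_eq, inner_add_right, add_div, add_smul]

lemma Pv_smul (v ξ : V3) (c : ℝ) : Pv v (c • ξ) = c • Pv v ξ := by
  simp only [Pv_eq, real_inner_smul_right, mul_div_assoc, mul_smul]

/-- The anisotropic rescaling `P_v ξ + ⟨v⟩ (I - P_v) ξ` of a vector. -/
def anisoVec (v ξ : V3) : V3 := Pv v ξ + jap v • (ξ - Pv v ξ)

lemma anisoVec_add_smul_self (v ξ : V3) (c : ℝ) :
    anisoVec v (ξ + c • v) = anisoVec v ξ + c • v := by
  simp only [anisoVec, Pv_add, Pv_smul, Pv_self]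
  module

lemma inner_Pv_sub_Pv (v ξ : V3) : ⟪Pv v ξ, ξ - Pv v ξ⟫ = 0 := by
  rw [Pv_eq, real_inner_smul_left, inner_sub_right, real_inner_smul_right,
    real_inner_self_eq_norm_sq]
  rcases eq_or_ne v 0 with h | h
  · simp [h]
  · have : ‖v‖ ≠ 0 := by simpa using h
    field_simp
    ring

lemma norm_anisoVec_sq (v ξ : V3) :
    ‖anisoVec v ξ‖ ^ 2 = ‖Pv v ξ‖ ^ 2 + jap v ^ 2 * ‖ξ - Pv v ξ‖ ^ 2 := by
  rw [anisoVec, norm_add_sq_real, real_inner_smul_right, inner_Pv_sub_Pv, norm_smul,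
    Real.norm_of_nonneg (jap_pos v).le]
  ring

lemma norm_Pv_le_anisoVec (v ξ : V3) : ‖Pv v ξ‖ ≤ ‖anisoVec v ξ‖ := by
  refine abs_le_of_sq_le_sq' ?_ (by positivity) |>.2
  rw [norm_anisoVec_sq]
  nlinarith [sq_nonneg (jap v * ‖ξ - Pv v ξ‖)]

lemma jap_mul_norm_sub_Pv_le (v ξ : V3) : jap v * ‖ξ - Pv v ξ‖ ≤ ‖anisoVec v ξ‖ := by
  refine abs_le_of_sq_le_sq' ?_ (by positivity) |>.2
  rw [norm_anisoVec_sq]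
  nlinarith [sq_nonneg ‖Pv v ξ‖]

lemma norm_le_anisoVec (v ξ : V3) : ‖ξ‖ ≤ ‖anisoVec v ξ‖ := by
  refine abs_le_of_sq_le_sq' ?_ (by positivity) |>.2
  rw [norm_anisoVec_sq]
  have h : ‖ξ‖ ^ 2 = ‖Pv v ξ‖ ^ 2 + ‖ξ - Pv v ξ‖ ^ 2 := by
    have := norm_add_sq_real (Pv v ξ) (ξ - Pv v ξ)
    rw [inner_Pv_sub_Pv, add_sub_cancel] at this
    linarith
  nlinarith [one_le_jap v, sq_nonneg ‖ξ - Pv v ξ‖,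
    mul_nonneg (mul_nonneg (sub_nonneg.2 (one_le_jap v)) (jap_pos v).le) (sq_nonneg ‖ξ - Pv v ξ‖),
    mul_nonneg (sub_nonneg.2 (one_le_jap v)) (sq_nonneg ‖ξ - Pv v ξ‖)]

lemma norm_sub_Pv_sub_le (v w ξ : V3) :
    ‖ξ - Pv (v - w) ξ‖ ≤ 3 * (jap w / jap v) * ‖anisoVec v ξ‖ := by
  have hv := jap_pos v
  have hw := jap_pos w
  have hw1 := one_le_jap w
  set z := v - w with hz
  have hlong : ‖Pv v ξ - Pv z (Pv v ξ)‖ ≤ 2 * (jap w / jap v) * ‖anisoVec v ξ‖ := by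
    have hP := norm_Pv_le_anisoVec v ξ
    rcases le_or_gt 1 ‖v‖ with h1 | h1
    · set t := ⟪v, ξ⟫ / ‖v‖ ^ 2 with ht
      have hPv : Pv v ξ = t • v := Pv_eq v ξ
      have hzw : v - Pv z v = w - Pv z w := by
        have e : Pv z v = Pv z z + Pv z w := by rw [← Pv_add, hz, sub_add_cancel]
        rw [e, Pv_self, hz]; abel
      have e1 : ‖Pv v ξ - Pv z (Pv v ξ)‖ ≤ |t| * jap w := by
        rw [hPv, Pv_smul, ← smul_sub, hzw, norm_smul, Real.norm_eq_abs]
        gcongr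
        exact (norm_sub_Pv_le z w).trans (norm_le_jap w)
      have e2 : |t| * ‖v‖ = ‖Pv v ξ‖ := by rw [hPv, norm_smul, Real.norm_eq_abs]
      have e3 := jap_le_two_mul_norm h1
      refine e1.trans ?_
      rw [mul_div_assoc', div_mul_eq_mul_div, le_div_iff₀ hv]
      calc |t| * jap w * jap v ≤ |t| * jap w * (2 * ‖v‖) := by gcongr
        _ = 2 * jap w * (|t| * ‖v‖) := by ring
        _ ≤ 2 * jap w * ‖anisoVec v ξ‖ := by rw [e2]; gcongr
    · have e3 := jap_le_two h1.le
      calc ‖Pv v ξ - Pv z (Pv v ξ)‖ ≤ ‖Pv v ξ‖ := norm_sub_Pv_le _ _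
        _ ≤ 1 * ‖anisoVec v ξ‖ := by rwa [one_mul]
        _ ≤ _ := by
          gcongr
          rw [mul_div_assoc', le_div_iff₀ hv]
          linarith
  have htrans : ‖(ξ - Pv v ξ) - Pv z (ξ - Pv v ξ)‖ ≤ (jap w / jap v) * ‖anisoVec v ξ‖ := by
    refine (norm_sub_Pv_le _ _).trans ?_
    rw [div_mul_eq_mul_div, le_div_iff₀ hv]
    nlinarith [jap_mul_norm_sub_Pv_le v ξ, norm_nonneg (anisoVec v ξ)]
  have hsplit : ξ - Pv z ξ = (Pv v ξ - Pv z (Pv v ξ)) + ((ξ - Pv v ξ) - Pv z (ξ - Pv v ξ)) := by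
    have e : Pv z ξ = Pv z (Pv v ξ) + Pv z (ξ - Pv v ξ) := by rw [← Pv_add, add_sub_cancel]
    rw [e]; abel
  rw [hsplit]
  refine (norm_add_le _ _).trans ?_
  linarith

lemma sum_aker_mul (γ : ℝ) (z ξ η : V3) :
    ∑ j, ∑ i, aker γ z i j * ξ i * η j = ‖z‖ ^ (γ + 2) * ⟪ξ - Pv z ξ, η - Pv z η⟫ := by
  rw [inner_sub_Pv, ← sum_mul_eq_inner, ← sum_mul_eq_inner, ← sum_mul_eq_inner]
  simp only [aker, Fin.sum_univ_three]
  simp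
  ring

lemma abs_sum_aker_mul_le (γ : ℝ) (v w ξ η : V3) :
    |∑ j, ∑ i, aker γ (v - w) i j * ξ i * η j| ≤
      9 * jap v ^ (-2 : ℝ) * ‖anisoVec v ξ‖ * ‖anisoVec v η‖ *
        (‖v - w‖ ^ (γ + 2) * jap w ^ (2 : ℝ)) := by
  have hv := jap_pos v
  have hw := jap_pos w
  rw [sum_aker_mul, abs_mul, abs_of_nonneg (by positivity)]
  have h : |⟪ξ - Pv (v - w) ξ, η - Pv (v - w) η⟫| ≤
      (3 * (jap w / jap v) * ‖anisoVec v ξ‖) * (3 * (jap w / jap v) * ‖anisoVec v η‖) :=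
    (abs_real_inner_le_norm _ _).trans (mul_le_mul (norm_sub_Pv_sub_le v w ξ)
      (norm_sub_Pv_sub_le v w η) (norm_nonneg _) (by positivity))
  refine (mul_le_mul_of_nonneg_left h (by positivity)).trans_eq ?_
  rw [Real.rpow_neg hv.le]
  norm_cast
  field_simp
  ring

lemma abs_aker_le (γ : ℝ) (z : V3) (i j : Fin 3) : |aker γ z i j| ≤ 2 * ‖z‖ ^ (γ + 2) := by
  have h1 : |z i| ≤ ‖z‖ := PiLp.norm_apply_le z i
  have h2 : |z j| ≤ ‖z‖ := PiLp.norm_apply_le z j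
  rw [aker, abs_mul, abs_of_nonneg (by positivity), mul_comm]
  gcongr
  refine (abs_sub _ _).trans ?_
  have h3 : |if i = j then (1 : ℝ) else 0| ≤ 1 := by split_ifs <;> simp
  have h4 : |z i * z j / ‖z‖ ^ 2| ≤ 1 := by
    rw [abs_div, abs_mul, abs_of_nonneg (sq_nonneg ‖z‖)]
    refine div_le_one_of_le₀ ?_ (by positivity)
    rw [sq]; gcongr
  linarith

lemma measurable_aker (γ : ℝ) (i j : Fin 3) : Measurable fun z : V3 => aker γ z i j := by
  unfold aker; fun_prop

lemma measurable_bker (γ : ℝ) (j : Fin 3) : Measurable fun z : V3 => bker γ z j := by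
  unfold bker; fun_prop

lemma sum_bker_mul (γ : ℝ) (z η : V3) :
    ∑ j, bker γ z j * η j = -2 * ‖z‖ ^ γ * ⟪z, η⟫ := by
  rw [← sum_mul_eq_inner]
  simp only [bker, Fin.sum_univ_three]
  ring

lemma norm_rpow_mul_norm_le (γ : ℝ) (z : V3) : ‖z‖ ^ γ * ‖z‖ ≤ ‖z‖ ^ (γ + 1) := by
  rcases eq_or_ne z 0 with h | h
  · simp only [h, norm_zero, mul_zero]; positivity
  · rw [Real.rpow_add_one (by simpa using h)]

lemma abs_sum_bker_mul_le (γ : ℝ) (z η : V3) :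
    |∑ j, bker γ z j * η j| ≤ 2 * ‖z‖ ^ (γ + 1) * ‖η‖ := by
  rw [sum_bker_mul, abs_mul, abs_mul, abs_neg, abs_two, abs_of_nonneg (by positivity)]
  calc 2 * ‖z‖ ^ γ * |⟪z, η⟫| ≤ 2 * ‖z‖ ^ γ * (‖z‖ * ‖η‖) := by
        gcongr; exact abs_real_inner_le_norm _ _
    _ = 2 * (‖z‖ ^ γ * ‖z‖) * ‖η‖ := by ring
    _ ≤ _ := by gcongr; exact norm_rpow_mul_norm_le γ z

lemma abs_bker_le (γ : ℝ) (z : V3) (j : Fin 3) : |bker γ z j| ≤ 2 * ‖z‖ ^ (γ + 1) := by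
  have h : |z j| ≤ ‖z‖ := PiLp.norm_apply_le z j
  rw [bker, abs_mul, abs_mul, abs_neg, abs_two, abs_of_nonneg (by positivity)]
  calc 2 * ‖z‖ ^ γ * |z j| ≤ 2 * ‖z‖ ^ γ * ‖z‖ := by gcongr
    _ = 2 * (‖z‖ ^ γ * ‖z‖) := by ring
    _ ≤ _ := by gcongr; exact norm_rpow_mul_norm_le γ z

lemma gradient_apply_eq_pd (u : V3 → ℝ) (v : V3) (i : Fin 3) : gradient u v i = pd i u v := by
  rw [pd, ← toDual_gradient, InnerProductSpace.toDual_apply_apply, EuclideanSpace.inner_single_right]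
  simp

lemma norm_gradient_eq (u : V3 → ℝ) (v : V3) : ‖gradient u v‖ = ‖fderiv ℝ u v‖ :=
  LinearIsometryEquiv.norm_map _ _

lemma integrable_norm_gradient_sq (F : SchwartzMap V3 ℝ) :
    Integrable fun v => ‖gradient F v‖ ^ 2 := by
  simp_rw [norm_gradient_eq]
  have h := ((SchwartzMap.fderivCLM ℝ V3 ℝ F).memLp 2).integrable_norm_pow (by norm_num)
  simpa using h

lemma continuous_gradient (F : SchwartzMap V3 ℝ) : Continuous (gradient F) := by
  refine (LinearIsometryEquiv.continuous _).comp ?_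
  exact (SchwartzMap.fderivCLM ℝ V3 ℝ F).continuous

lemma integrable_pd (G : SchwartzMap V3 ℝ) (i : Fin 3) : Integrable (pd i G) := by
  have h := (LineDeriv.lineDerivOp (EuclideanSpace.single i (1 : ℝ)) G).integrable (μ := volume)
  exact h.congr (.of_forall fun x => SchwartzMap.lineDerivOp_apply_eq_fderiv _ _ _)

lemma integrable_sq (F : SchwartzMap V3 ℝ) : Integrable fun v => F v ^ 2 :=
  (F.memLp 2).integrable_sq

section Hardy

variable {ε : ℝ} (v : V3)

lemma hasFDerivAt_regularized (hε : 0 < ε) (i : Fin 3) (w : V3) :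
    ∃ L : V3 →L[ℝ] ℝ, HasFDerivAt (fun w : V3 => (w i - v i) * (‖w - v‖ ^ 2 + ε)⁻¹) L w ∧
      L (EuclideanSpace.single i 1) =
        (‖w - v‖ ^ 2 + ε)⁻¹ - 2 * (w i - v i) ^ 2 * ((‖w - v‖ ^ 2 + ε)⁻¹) ^ 2 := by
  have hρ : ‖w - v‖ ^ 2 + ε ≠ 0 := by positivity
  have h1 : HasFDerivAt (fun w : V3 => w i - v i)
      (EuclideanSpace.proj i : V3 →L[ℝ] ℝ) w :=
    (EuclideanSpace.proj i : V3 →L[ℝ] ℝ).hasFDerivAt.sub_const _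
  have h2 : HasFDerivAt (fun w : V3 => ‖w - v‖ ^ 2 + ε) (2 • innerSL ℝ (w - v)) w := by
    have := ((hasFDerivAt_id w).sub_const v).norm_sq.add_const ε
    simpa using this
  have h3 := h1.mul ((hasDerivAt_inv hρ).comp_hasFDerivAt w h2)
  refine ⟨_, h3, ?_⟩
  simp [EuclideanSpace.inner_single_right]
  field_simp
  ring

lemma abs_coord_le_norm (z : V3) (i : Fin 3) : |z i| ≤ ‖z‖ := PiLp.norm_apply_le z i

lemma integral_regularized_mul_pd (hε : 0 < ε) (G : SchwartzMap V3 ℝ) (i : Fin 3) :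
    Integrable (fun w => (w i - v i) * (‖w - v‖ ^ 2 + ε)⁻¹ * pd i G w) ∧
    Integrable (fun w => ((‖w - v‖ ^ 2 + ε)⁻¹ -
      2 * (w i - v i) ^ 2 * ((‖w - v‖ ^ 2 + ε)⁻¹) ^ 2) * G w) ∧
    ∫ w : V3, (w i - v i) * (‖w - v‖ ^ 2 + ε)⁻¹ * pd i G w =
      -∫ w : V3, ((‖w - v‖ ^ 2 + ε)⁻¹ -
        2 * (w i - v i) ^ 2 * ((‖w - v‖ ^ 2 + ε)⁻¹) ^ 2) * G w := by
  have hρ : ∀ w : V3, 0 < ‖w - v‖ ^ 2 + ε := fun w => by positivity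
  have hc : Continuous fun w : V3 => (‖w - v‖ ^ 2 + ε)⁻¹ :=
    Continuous.inv₀ (by fun_prop) fun w => (hρ w).ne'
  have hci : Continuous fun w : V3 => w i - v i := by fun_prop
  have hle : ∀ w : V3, (‖w - v‖ ^ 2 + ε)⁻¹ ≤ ε⁻¹ := fun w =>
    inv_anti₀ hε (by nlinarith [sq_nonneg ‖w - v‖])
  have hX : ∀ w : V3, ‖(w i - v i) * (‖w - v‖ ^ 2 + ε)⁻¹‖ ≤ 1 + ε⁻¹ := fun w => by
    have h := abs_coord_le_norm (w - v) i
    rw [PiLp.sub_apply] at h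
    rw [norm_mul, Real.norm_eq_abs, Real.norm_of_nonneg (inv_nonneg.2 (hρ w).le),
      ← div_eq_mul_inv, div_le_iff₀ (hρ w)]
    have : (1 + ε⁻¹) * (‖w - v‖ ^ 2 + ε) = ‖w - v‖ ^ 2 + ε + ε⁻¹ * ‖w - v‖ ^ 2 + 1 := by
      field_simp; ring
    rw [this]
    have : 0 ≤ ε⁻¹ * ‖w - v‖ ^ 2 := by positivity
    nlinarith [sq_nonneg (‖w - v‖ - 1)]
  have hD : ∀ w : V3, ‖(‖w - v‖ ^ 2 + ε)⁻¹ -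
      2 * (w i - v i) ^ 2 * ((‖w - v‖ ^ 2 + ε)⁻¹) ^ 2‖ ≤ 3 * ε⁻¹ := fun w => by
    have h := abs_coord_le_norm (w - v) i
    rw [PiLp.sub_apply] at h
    have h2 : (w i - v i) ^ 2 ≤ ‖w - v‖ ^ 2 + ε := by
      rw [← sq_abs]
      nlinarith [abs_nonneg (w i - v i)]
    have h0 := inv_pos.2 (hρ w)
    have h3 : (w i - v i) ^ 2 * ((‖w - v‖ ^ 2 + ε)⁻¹) ^ 2 ≤ (‖w - v‖ ^ 2 + ε)⁻¹ := by
      calc (w i - v i) ^ 2 * ((‖w - v‖ ^ 2 + ε)⁻¹) ^ 2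
          ≤ (‖w - v‖ ^ 2 + ε) * ((‖w - v‖ ^ 2 + ε)⁻¹) ^ 2 := by gcongr
        _ = _ := by have := (hρ w).ne'; field_simp
    have h4 : 0 ≤ (w i - v i) ^ 2 * ((‖w - v‖ ^ 2 + ε)⁻¹) ^ 2 := by positivity
    rw [Real.norm_eq_abs, abs_le]
    constructor <;> nlinarith [hle w]
  have hfd : ∀ w : V3, fderiv ℝ (fun w : V3 => (w i - v i) * (‖w - v‖ ^ 2 + ε)⁻¹) w
      (EuclideanSpace.single i 1) = (‖w - v‖ ^ 2 + ε)⁻¹ -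
        2 * (w i - v i) ^ 2 * ((‖w - v‖ ^ 2 + ε)⁻¹) ^ 2 := fun w => by
    obtain ⟨L, hL, hL'⟩ := hasFDerivAt_regularized v hε i w
    rw [hL.fderiv, hL']
  have i1 : Integrable (fun w => (w i - v i) * (‖w - v‖ ^ 2 + ε)⁻¹ * pd i G w) :=
    (integrable_pd G i).bdd_mul (hci.mul hc).aestronglyMeasurable (.of_forall hX)
  have i2 : Integrable (fun w => ((‖w - v‖ ^ 2 + ε)⁻¹ -
      2 * (w i - v i) ^ 2 * ((‖w - v‖ ^ 2 + ε)⁻¹) ^ 2) * G w) := by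
    refine G.integrable.bdd_mul ?_ (.of_forall hD)
    exact (hc.sub ((continuous_const.mul (hci.pow 2)).mul (hc.pow 2))).aestronglyMeasurable
  have i3 : Integrable (fun w => (w i - v i) * (‖w - v‖ ^ 2 + ε)⁻¹ * G w) :=
    G.integrable.bdd_mul (hci.mul hc).aestronglyMeasurable (.of_forall hX)
  refine ⟨i1, i2, ?_⟩
  have key := integral_mul_fderiv_eq_neg_fderiv_mul_of_integrable (μ := (volume : Measure V3))
    (f := fun w : V3 => (w i - v i) * (‖w - v‖ ^ 2 + ε)⁻¹) (g := G)
    (v := EuclideanSpace.single i 1) (by simp_rw [hfd]; exact i2) i1 i3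
    (fun w _ => by
      obtain ⟨L, hL, -⟩ := hasFDerivAt_regularized v hε i w
      exact hL.differentiableAt) (fun w _ => (G.hasFDerivAt w).differentiableAt)
  simp_rw [hfd] at key
  exact key

lemma integral_sq_mul_regularized_le (hε : 0 < ε) (F : SchwartzMap V3 ℝ) :
    ∫ w : V3, F w ^ 2 * (‖w - v‖ ^ 2 + ε)⁻¹ ≤ 4 * ∫ w : V3, ‖gradient F w‖ ^ 2 := by
  set G : SchwartzMap V3 ℝ := SchwartzMap.smulLeftCLM ℝ (F : V3 → ℝ) F with hG
  have hGa : ∀ w, G w = F w ^ 2 := fun w => by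
    rw [hG, SchwartzMap.smulLeftCLM_apply_apply F.hasTemperateGrowth, smul_eq_mul, sq]
  have hGp : ∀ i w, pd i G w = 2 * F w * gradient F w i := fun i w => by
    have h : (G : V3 → ℝ) = fun w => F w ^ 2 := funext hGa
    rw [gradient_apply_eq_pd, pd, pd, h, ((F.hasFDerivAt w).pow 2).fderiv]
    simp
  have hρ : ∀ w : V3, 0 < ‖w - v‖ ^ 2 + ε := fun w => by positivity
  have hc : Continuous fun w : V3 => (‖w - v‖ ^ 2 + ε)⁻¹ :=
    Continuous.inv₀ (by fun_prop) fun w => (hρ w).ne'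
  have hle : ∀ w : V3, (‖w - v‖ ^ 2 + ε)⁻¹ ≤ ε⁻¹ := fun w =>
    inv_anti₀ hε (by nlinarith [sq_nonneg ‖w - v‖])
  have h := integral_regularized_mul_pd v hε G
  have iF : Integrable fun w : V3 => F w ^ 2 * (‖w - v‖ ^ 2 + ε)⁻¹ :=
    (integrable_sq F).mul_bdd (c := ε⁻¹) hc.aestronglyMeasurable (.of_forall fun w => by
      rw [Real.norm_of_nonneg (inv_nonneg.2 (hρ w).le)]; exact hle w)
  have hsum := Finset.sum_congr (rfl : (Finset.univ : Finset (Fin 3)) = _) fun i _ => (h i).2.2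
  rw [Finset.sum_neg_distrib, ← integral_finsetSum _ fun i _ => (h i).1,
    ← integral_finsetSum _ fun i _ => (h i).2.1] at hsum
  have hnsq : ∀ w : V3, ‖w - v‖ ^ 2 = (w 0 - v 0) ^ 2 + (w 1 - v 1) ^ 2 + (w 2 - v 2) ^ 2 :=
    fun w => by simp [EuclideanSpace.norm_sq_eq, Fin.sum_univ_three]
  have hlow : ∫ w : V3, F w ^ 2 * (‖w - v‖ ^ 2 + ε)⁻¹ ≤
      ∫ w : V3, ∑ i, ((‖w - v‖ ^ 2 + ε)⁻¹ -
        2 * (w i - v i) ^ 2 * ((‖w - v‖ ^ 2 + ε)⁻¹) ^ 2) * G w := by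
    refine integral_mono iF (integrable_finsetSum _ fun i _ => (h i).2.1) fun w => ?_
    have e : ∑ i, ((‖w - v‖ ^ 2 + ε)⁻¹ -
        2 * (w i - v i) ^ 2 * ((‖w - v‖ ^ 2 + ε)⁻¹) ^ 2) * G w =
        F w ^ 2 * (‖w - v‖ ^ 2 + ε)⁻¹ + 2 * ε * (F w * (‖w - v‖ ^ 2 + ε)⁻¹) ^ 2 := by
      rw [hGa, ← Finset.sum_mul, Finset.sum_sub_distrib, ← Finset.sum_mul, ← Finset.mul_sum,
        Fin.sum_univ_three fun i => (w i - v i) ^ 2, ← hnsq]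
      have := (hρ w).ne'
      simp only [Finset.sum_const, Finset.card_univ, Fintype.card_fin, nsmul_eq_mul]
      push_cast
      field_simp
      ring
    change _ ≤ ∑ i, _
    rw [e]
    have : 0 ≤ 2 * ε * (F w * (‖w - v‖ ^ 2 + ε)⁻¹) ^ 2 := by positivity
    linarith
  have hup : -∫ w : V3, ∑ i, (w i - v i) * (‖w - v‖ ^ 2 + ε)⁻¹ * pd i G w ≤
      ∫ w : V3, (2⁻¹ * (F w ^ 2 * (‖w - v‖ ^ 2 + ε)⁻¹) + 2 * ‖gradient F w‖ ^ 2) := by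
    rw [← integral_neg]
    refine integral_mono (integrable_finsetSum _ fun i _ => (h i).1).neg
      ((iF.const_mul _).add ((integrable_norm_gradient_sq F).const_mul _)) fun w => ?_
    have e : ∑ i, (w i - v i) * (‖w - v‖ ^ 2 + ε)⁻¹ * pd i G w =
        2 * (F w * (‖w - v‖ ^ 2 + ε)⁻¹) * ⟪w - v, gradient F w⟫ := by
      rw [real_inner_comm, ← sum_mul_eq_inner]
      simp only [hGp, Fin.sum_univ_three, PiLp.sub_apply]
      ring
    change -∑ i, _ ≤ 2⁻¹ * (F w ^ 2 * (‖w - v‖ ^ 2 + ε)⁻¹) + 2 * ‖gradient F w‖ ^ 2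
    rw [e]
    set s := (‖w - v‖ ^ 2 + ε)⁻¹ with hs
    have hs0 : 0 < s := inv_pos.2 (hρ w)
    have hi : |⟪w - v, gradient F w⟫| ≤ ‖w - v‖ * ‖gradient F w‖ := abs_real_inner_le_norm _ _
    have h1 : -(2 * (F w * s) * ⟪w - v, gradient F w⟫) ≤
        2 * (|F w| * s) * (‖w - v‖ * ‖gradient F w‖) := by
      refine (neg_le_abs _).trans ?_
      rw [abs_mul, abs_mul, abs_mul, abs_two, abs_of_pos hs0]
      gcongr
    have h2 : s * (s * ‖w - v‖ ^ 2) ≤ s * 1 := by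
      gcongr
      rw [hs, inv_mul_le_iff₀ (hρ w)]
      linarith
    have h3 : F w ^ 2 * (s * (s * ‖w - v‖ ^ 2)) ≤ F w ^ 2 * (s * 1) := by gcongr
    have h4 : F w ^ 2 = |F w| ^ 2 := (sq_abs _).symm
    rw [h4] at h3 ⊢
    nlinarith [sq_nonneg (|F w| * s * ‖w - v‖ - 2 * ‖gradient F w‖)]
  rw [integral_add (iF.const_mul _) ((integrable_norm_gradient_sq F).const_mul _),
    integral_const_mul, integral_const_mul] at hup
  linarith

lemma integrable_sq_mul_norm_rpow (F : SchwartzMap V3 ℝ) :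
    Integrable fun w : V3 => F w ^ 2 * ‖v - w‖ ^ (-2 : ℝ) := by
  obtain ⟨C, -, hC⟩ := exists_integral_singular_weight_le (a := 2) (c := 0) (b := 4) (by norm_num)
    (by norm_num) le_rfl (by norm_num) (by norm_num)
  obtain ⟨M, hM0, hM⟩ := (weighted 2 F).decay 0 0
  refine Integrable.mono' ((hC v).1.const_mul (M ^ 2)) ?_ (.of_forall fun w => ?_)
  · have := F.continuous.measurable
    exact Measurable.aestronglyMeasurable (by fun_prop)
  · have h := hM w
    have hw := jap_pos w
    rw [pow_zero, one_mul, norm_iteratedFDeriv_zero, weighted_apply, norm_mul,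
      Real.norm_of_nonneg (by positivity), Real.norm_eq_abs] at h
    rw [Real.norm_of_nonneg (by positivity), neg_zero, Real.rpow_zero, mul_one, mul_comm,
      mul_left_comm]
    gcongr
    have h2 : (jap w ^ (2 : ℝ) * |F w|) ^ 2 ≤ M ^ 2 := by gcongr
    rw [mul_pow, sq_abs] at h2
    rw [show (-4 : ℝ) = -(2 * 2 : ℝ) by norm_num, Real.rpow_neg hw.le, ← div_eq_mul_inv,
      le_div_iff₀ (by positivity), Real.rpow_mul hw.le]
    norm_cast at h2 ⊢
    linarith

/-- Hardy's inequality in dimension three. -/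
lemma integral_sq_mul_norm_rpow_le (F : SchwartzMap V3 ℝ) :
    ∫ w : V3, F w ^ 2 * ‖v - w‖ ^ (-2 : ℝ) ≤ 4 * ∫ w : V3, ‖gradient F w‖ ^ 2 := by
  have hne : ∀ᵐ w : V3, w ≠ v := by
    simp [ae_iff]
  have hlim : Tendsto (fun n : ℕ => ∫ w : V3, F w ^ 2 * (‖w - v‖ ^ 2 + 1 / ((n : ℝ) + 1))⁻¹) atTop
      (nhds (∫ w : V3, F w ^ 2 * ‖v - w‖ ^ (-2 : ℝ))) := by
    refine tendsto_integral_of_dominated_convergence _ (fun n => ?_)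
      (integrable_sq_mul_norm_rpow v F) (fun n => ?_) ?_
    · have := F.continuous.measurable
      exact Measurable.aestronglyMeasurable (by fun_prop)
    · filter_upwards [hne] with w hw
      have h0 : 0 < ‖w - v‖ := norm_pos_iff.2 (sub_ne_zero.2 hw)
      rw [Real.norm_of_nonneg (by positivity), Real.rpow_neg (norm_nonneg _), norm_sub_rev v w]
      norm_cast
      gcongr
      have : 0 < 1 / ((n : ℝ) + 1) := by positivity
      push_cast
      linarith
    · filter_upwards [hne] with w hw
      have h0 : 0 < ‖w - v‖ := norm_pos_iff.2 (sub_ne_zero.2 hw)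
      rw [Real.rpow_neg (norm_nonneg _), norm_sub_rev v w]
      refine Tendsto.const_mul _ (Tendsto.inv₀ ?_ (by positivity))
      have := (tendsto_one_div_add_atTop_nhds_zero_nat (𝕜 := ℝ)).const_add (‖w - v‖ ^ 2)
      simpa using this
  exact le_of_tendsto' hlim fun n => integral_sq_mul_regularized_le v (by positivity) F

end Hardy

lemma rpow_sq_eq {x : ℝ} (hx : 0 ≤ x) (r : ℝ) : (x ^ r) ^ 2 = x ^ (2 * r) := by
  rw [← Real.rpow_mul_natCast hx, mul_comm]; norm_num

lemma exists_integral_norm_rpow_mul_le {γ θ : ℝ} (hγ : γ ∈ Set.Ico (-3 : ℝ) (-2))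
    (hθ : 7 / 2 < θ) : ∃ C > 0, ∀ (f : SchwartzMap V3 ℝ) (v : V3),
      Integrable (fun w => ‖v - w‖ ^ (γ + 2) * jap w ^ (2 : ℝ) * |f w|) ∧
      ∫ w, ‖v - w‖ ^ (γ + 2) * jap w ^ (2 : ℝ) * |f w| ≤ C * L2wNorm θ f * jap v ^ (γ + 2) := by
  obtain ⟨h1, h2⟩ := hγ
  obtain ⟨C, hC, h⟩ := exists_integral_singular_weight_le (a := -(2 * (γ + 2))) (c := 0)
    (b := 2 * (θ - 2)) (by linarith) (by linarith) le_rfl (by linarith) (by linarith)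
  refine ⟨√C, by positivity, fun f v => ?_⟩
  have hv := jap_pos v
  set P : V3 → ℝ := fun w => ‖v - w‖ ^ (γ + 2) * jap w ^ (2 - θ) with hP
  have hP0 : ∀ w, 0 ≤ P w := fun w => by have := jap_pos w; positivity
  have hPsq : ∀ w, P w ^ 2 = ‖v - w‖ ^ (-(-(2 * (γ + 2)))) * jap (v - w) ^ (-(0 : ℝ)) *
      jap w ^ (-(2 * (θ - 2))) := fun w => by
    rw [hP, mul_pow, rpow_sq_eq (norm_nonneg _), rpow_sq_eq (jap_pos w).le, neg_neg, neg_zero,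
      Real.rpow_zero, mul_one]
    congr 2
    ring
  have hPm : Measurable P :=
    Measurable.mul (by fun_prop) (continuous_jap_rpow _).measurable
  have hP2 : MemLp P 2 := by
    rw [memLp_two_iff_integrable_sq hPm.aestronglyMeasurable]
    simp_rw [hPsq]
    exact (h v).1
  have hprod : ∀ w, |P w| * |weighted θ f w| = ‖v - w‖ ^ (γ + 2) * jap w ^ (2 : ℝ) * |f w| := by
    intro w
    have hw := jap_pos w
    rw [abs_of_nonneg (hP0 w), weighted_apply, abs_mul, abs_of_nonneg (by positivity), hP,
      show (2 : ℝ) = (2 - θ) + θ by ring, Real.rpow_add hw]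
    ring_nf
  have hcs := integral_abs_mul_le_sqrt hP2 ((weighted θ f).memLp 2)
  have hfun := (hP2.integrable_mul ((weighted θ f).memLp 2)).abs
  simp only [Pi.mul_apply, abs_mul, hprod, hPsq] at hcs hfun
  refine ⟨hfun, hcs.trans ?_⟩
  have e : √(C * jap v ^ (-(-(2 * (γ + 2)) + 0))) = √C * jap v ^ (γ + 2) := by
    rw [Real.sqrt_mul hC.le, add_zero, neg_neg, ← rpow_sq_eq hv.le, Real.sqrt_sq (by positivity)]
  have e2 : √(∫ w, weighted θ f w ^ 2) = L2wNorm θ f := by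
    simp_rw [weighted_apply]; rfl
  rw [e2]
  calc _ ≤ √(C * jap v ^ (-(-(2 * (γ + 2)) + 0))) * L2wNorm θ f := by
        gcongr
        · exact Real.sqrt_nonneg _
        · exact (h v).2
    _ = _ := by rw [e]; ring

lemma exists_integral_norm_rpow_mul_le_H1Norm {γ θ' : ℝ} (hγ : γ ∈ Set.Ico (-3 : ℝ) (-2))
    (hθ' : 9 / 4 < θ') : ∃ C > 0, ∀ (f : SchwartzMap V3 ℝ) (v : V3),
      Integrable (fun w => ‖v - w‖ ^ (γ + 1) * |f w|) ∧
      ∫ w, ‖v - w‖ ^ (γ + 1) * |f w| ≤ C * H1Norm (weighted θ' f) * jap v ^ (γ + 1) := by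
  obtain ⟨h1, h2⟩ := hγ
  obtain ⟨C, hC, h⟩ := exists_integral_singular_weight_le (a := -(2 * (γ + 2))) (c := 2)
    (b := 2 * θ') (by linarith) (by linarith) (by norm_num) (by linarith) (by linarith)
  refine ⟨√C * 2, by positivity, fun f v => ?_⟩
  have hv := jap_pos v
  set F := weighted θ' f with hF
  set P : V3 → ℝ := fun w => ‖v - w‖ ^ (γ + 2) * jap (v - w) ^ (-1 : ℝ) * jap w ^ (-θ') with hP
  set Φ : V3 → ℝ := fun w => |F w| * (jap (v - w) ^ (1 : ℝ) * ‖v - w‖ ^ (-1 : ℝ)) with hΦ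
  have hP0 : ∀ w, 0 ≤ P w := fun w => by
    have := jap_pos w
    have := jap_pos (v - w)
    positivity
  have hΦ0 : ∀ w, 0 ≤ Φ w := fun w => by
    have := jap_pos (v - w)
    positivity
  have hPsq : ∀ w, P w ^ 2 = ‖v - w‖ ^ (-(-(2 * (γ + 2)))) * jap (v - w) ^ (-(2 : ℝ)) *
      jap w ^ (-(2 * θ')) := fun w => by
    rw [hP, mul_pow, mul_pow, rpow_sq_eq (norm_nonneg _), rpow_sq_eq (jap_pos w).le,
      rpow_sq_eq (jap_pos _).le, neg_neg]
    ring_nf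
  have hΦsq : ∀ w, Φ w ^ 2 ≤ F w ^ 2 + F w ^ 2 * ‖v - w‖ ^ (-2 : ℝ) := fun w => by
    have e : Φ w ^ 2 = F w ^ 2 * (‖v - w‖ ^ (-1 : ℝ) * ‖v - w‖) ^ 2 +
        F w ^ 2 * ‖v - w‖ ^ (-2 : ℝ) := by
      rw [hΦ, mul_pow, mul_pow, sq_abs, Real.rpow_one, jap_sq,
        show ‖v - w‖ ^ (-2 : ℝ) = (‖v - w‖ ^ (-1 : ℝ)) ^ 2 by
          rw [rpow_sq_eq (norm_nonneg _)]; norm_num]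
      ring
    rw [e]
    gcongr
    refine mul_le_of_le_one_right (sq_nonneg _) (pow_le_one₀ (by positivity) ?_)
    rw [Real.rpow_neg_one]
    exact inv_mul_le_one
  have hjm : ∀ r : ℝ, Measurable fun w : V3 => jap (v - w) ^ r := fun r =>
    (continuous_jap_rpow r).measurable.comp (by fun_prop)
  have hPm : Measurable P :=
    Measurable.mul (Measurable.mul (by fun_prop) (hjm _)) (continuous_jap_rpow _).measurable
  have hΦm : Measurable Φ :=
    Measurable.mul F.continuous.measurable.abs (Measurable.mul (hjm _) (by fun_prop))
  have hP2 : MemLp P 2 := by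
    rw [memLp_two_iff_integrable_sq hPm.aestronglyMeasurable]
    simp_rw [hPsq]
    exact (h v).1
  have hΦi := (integrable_sq F).add (integrable_sq_mul_norm_rpow v F)
  have hΦsi : Integrable fun w => Φ w ^ 2 :=
    hΦi.mono' (hΦm.pow_const 2).aestronglyMeasurable (.of_forall fun w => by
      rw [Real.norm_of_nonneg (sq_nonneg _)]; exact hΦsq w)
  have hΦ2 : MemLp Φ 2 := (memLp_two_iff_integrable_sq hΦm.aestronglyMeasurable).2 hΦsi
  have hprod : ∀ w, |P w| * |Φ w| = ‖v - w‖ ^ (γ + 1) * |f w| := by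
    intro w
    have hw := jap_pos w
    have hvw := jap_pos (v - w)
    rw [abs_of_nonneg (hP0 w), abs_of_nonneg (hΦ0 w)]
    simp only [hP, hΦ, hF]
    rw [weighted_apply, abs_mul, abs_of_nonneg (by positivity : 0 ≤ jap w ^ θ')]
    have e1 : jap w ^ (-θ') * jap w ^ θ' = 1 := by rw [← Real.rpow_add hw]; simp
    have e2 : jap (v - w) ^ (-1 : ℝ) * jap (v - w) ^ (1 : ℝ) = 1 := by
      rw [← Real.rpow_add hvw]; simp
    have e3 : ‖v - w‖ ^ (γ + 2) * ‖v - w‖ ^ (-1 : ℝ) = ‖v - w‖ ^ (γ + 1) := by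
      rw [← Real.rpow_add' (norm_nonneg _) (by linarith)]
      congr 1; ring
    calc _ = (‖v - w‖ ^ (γ + 2) * ‖v - w‖ ^ (-1 : ℝ)) * (jap w ^ (-θ') * jap w ^ θ') *
          (jap (v - w) ^ (-1 : ℝ) * jap (v - w) ^ (1 : ℝ)) * |f w| := by ring
      _ = _ := by rw [e1, e2, e3]; ring
  have hcs := integral_abs_mul_le_sqrt hP2 hΦ2
  have hfun := (hP2.integrable_mul hΦ2).abs
  simp only [Pi.mul_apply, abs_mul, hprod] at hcs hfun
  refine ⟨hfun, hcs.trans ?_⟩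
  have b1 : √(∫ w, P w ^ 2) ≤ √C * jap v ^ (γ + 1) := by
    simp_rw [hPsq]
    refine (Real.sqrt_le_sqrt (h v).2).trans_eq ?_
    rw [Real.sqrt_mul hC.le, show -(-(2 * (γ + 2)) + 2) = 2 * (γ + 1) by ring, ← rpow_sq_eq hv.le,
      Real.sqrt_sq (by positivity)]
  have b2 : √(∫ w, Φ w ^ 2) ≤ 2 * H1Norm F := by
    rw [H1Norm]
    refine Real.sqrt_le_iff.2 ⟨by positivity, ?_⟩
    have n1 : 0 ≤ ∫ w, F w ^ 2 := integral_nonneg fun w => sq_nonneg _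
    have n2 : 0 ≤ ∫ w, ‖gradient F w‖ ^ 2 := integral_nonneg fun w => sq_nonneg _
    rw [mul_pow, Real.sq_sqrt (by positivity)]
    have := integral_mono hΦsi hΦi hΦsq
    simp only [Pi.add_apply] at this
    rw [integral_add (integrable_sq F) (integrable_sq_mul_norm_rpow v F)] at this
    linarith [integral_sq_mul_norm_rpow_le v F]
  calc _ ≤ (√C * jap v ^ (γ + 1)) * (2 * H1Norm F) :=
        mul_le_mul b1 b2 (Real.sqrt_nonneg _) (by positivity)
    _ = _ := by ring

lemma exists_abs_sum_conv_aker_le {γ θ : ℝ} (hγ : γ ∈ Set.Ico (-3 : ℝ) (-2)) (hθ : 7 / 2 < θ) :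
    ∃ C > 0, ∀ (f : SchwartzMap V3 ℝ) (v ξ η : V3),
      |∑ j, ∑ i, conv3 (fun z => aker γ z i j) f v * ξ i * η j| ≤
        C * L2wNorm θ f * jap v ^ γ * ‖anisoVec v ξ‖ * ‖anisoVec v η‖ := by
  obtain ⟨C, hC, h⟩ := exists_integral_norm_rpow_mul_le hγ hθ
  refine ⟨9 * C, by positivity, fun f v ξ η => ?_⟩
  have hv := jap_pos v
  obtain ⟨hi, hle⟩ := h f v
  have hfun : ∀ i j, Integrable fun w => aker γ (v - w) i j * f w * ξ i * η j := fun i j => by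
    refine Integrable.mul_const (Integrable.mul_const (Integrable.mono' (hi.const_mul 2) ?_
      (.of_forall fun w => ?_)) _) _
    · exact (((measurable_aker γ i j).comp (measurable_const.sub measurable_id)).mul
        f.continuous.measurable).aestronglyMeasurable
    · rw [norm_mul, Real.norm_eq_abs, Real.norm_eq_abs]
      have h1 : 1 ≤ jap w ^ (2 : ℝ) := Real.one_le_rpow (one_le_jap w) (by norm_num)
      calc |aker γ (v - w) i j| * |f w| ≤ (2 * ‖v - w‖ ^ (γ + 2)) * |f w| := by
            gcongr; exact abs_aker_le _ _ _ _
        _ = 2 * (‖v - w‖ ^ (γ + 2) * 1 * |f w|) := by ring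
        _ ≤ _ := by gcongr
  have e : ∑ j, ∑ i, conv3 (fun z => aker γ z i j) f v * ξ i * η j =
      ∫ w, (∑ j, ∑ i, aker γ (v - w) i j * ξ i * η j) * f w := by
    simp only [conv3, ← integral_mul_const]
    simp_rw [← integral_finsetSum Finset.univ fun i _ => hfun i _]
    rw [← integral_finsetSum Finset.univ fun j _ => integrable_finsetSum _ fun i _ => hfun i j]
    congr 1
    ext w
    simp only [Finset.sum_mul]
    refine Finset.sum_congr rfl fun j _ => Finset.sum_congr rfl fun i _ => by ring
  rw [e, ← Real.norm_eq_abs]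
  refine (norm_integral_le_of_norm_le (hi.const_mul
    (9 * jap v ^ (-2 : ℝ) * ‖anisoVec v ξ‖ * ‖anisoVec v η‖)) (.of_forall fun w => ?_)).trans ?_
  · rw [norm_mul, Real.norm_eq_abs, Real.norm_eq_abs, ← mul_assoc]
    gcongr
    exact abs_sum_aker_mul_le γ v w ξ η
  · rw [integral_const_mul]
    calc _ ≤ 9 * jap v ^ (-2 : ℝ) * ‖anisoVec v ξ‖ * ‖anisoVec v η‖ *
          (C * L2wNorm θ f * jap v ^ (γ + 2)) := by gcongr
      _ = 9 * C * L2wNorm θ f * (jap v ^ (-2 : ℝ) * jap v ^ (γ + 2)) * ‖anisoVec v ξ‖ *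
          ‖anisoVec v η‖ := by ring
      _ = _ := by rw [← Real.rpow_add hv]; ring_nf

lemma exists_abs_sum_conv_bker_le {γ θ' : ℝ} (hγ : γ ∈ Set.Ico (-3 : ℝ) (-2)) (hθ' : 9 / 4 < θ') :
    ∃ C > 0, ∀ (f : SchwartzMap V3 ℝ) (v η : V3),
      |∑ j, conv3 (fun z => bker γ z j) f v * η j| ≤
        C * H1Norm (weighted θ' f) * jap v ^ (γ / 2) * ‖η‖ := by
  obtain ⟨C, hC, h⟩ := exists_integral_norm_rpow_mul_le_H1Norm hγ hθ'
  refine ⟨2 * C, by positivity, fun f v η => ?_⟩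
  obtain ⟨hi, hle⟩ := h f v
  have hH : 0 ≤ H1Norm (weighted θ' f) := Real.sqrt_nonneg _
  have hfun : ∀ j, Integrable fun w => bker γ (v - w) j * f w * η j := fun j => by
    refine Integrable.mul_const (Integrable.mono' (hi.const_mul 2) ?_
      (.of_forall fun w => ?_)) _
    · exact (((measurable_bker γ j).comp (measurable_const.sub measurable_id)).mul
        f.continuous.measurable).aestronglyMeasurable
    · rw [norm_mul, Real.norm_eq_abs, Real.norm_eq_abs, ← mul_assoc]
      gcongr
      exact abs_bker_le _ _ _
  have e : ∑ j, conv3 (fun z => bker γ z j) f v * η j =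
      ∫ w, (∑ j, bker γ (v - w) j * η j) * f w := by
    simp only [conv3, ← integral_mul_const]
    rw [← integral_finsetSum Finset.univ fun j _ => hfun j]
    congr 1
    ext w
    rw [Finset.sum_mul]
    exact Finset.sum_congr rfl fun j _ => by ring
  rw [e, ← Real.norm_eq_abs]
  refine (norm_integral_le_of_norm_le (hi.const_mul (2 * ‖η‖)) (.of_forall fun w => ?_)).trans ?_
  · rw [norm_mul, Real.norm_eq_abs, Real.norm_eq_abs, ← mul_assoc]
    gcongr
    refine (abs_sum_bker_mul_le γ (v - w) η).trans_eq (by ring)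
  · rw [integral_const_mul]
    have hp : jap v ^ (γ + 1) ≤ jap v ^ (γ / 2) :=
      Real.rpow_le_rpow_of_exponent_le (one_le_jap v) (by linarith [hγ.2])
    calc _ ≤ 2 * ‖η‖ * (C * H1Norm (weighted θ' f) * jap v ^ (γ / 2)) := by
          gcongr; exact hle.trans (by gcongr)
      _ = _ := by ring

lemma pd_jap_rpow_mul (r : ℝ) {u : V3 → ℝ} {v : V3} (hu : DifferentiableAt ℝ u v) (i : Fin 3) :
    pd i (fun w => jap w ^ r * u w) v = jap v ^ r * (pd i u v + r / jap v ^ 2 * v i * u v) := by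
  have hv := jap_pos v
  have hpos : 0 < 1 + ‖v‖ ^ 2 := by positivity
  have h1 : HasFDerivAt (fun w : V3 => 1 + ‖w‖ ^ 2) _ v :=
    ((hasFDerivAt_id v).norm_sq).const_add 1
  have h2 := (h1.rpow_const (p := r / 2) (Or.inl hpos.ne')).mul hu.hasFDerivAt
  have e : (fun w => jap w ^ r * u w) = (fun w : V3 => (1 + ‖w‖ ^ 2) ^ (r / 2)) * u := by
    ext w
    rw [Pi.mul_apply, jap_rpow_eq]
  rw [pd, e, h2.fderiv, jap_rpow_eq r v, jap_sq, Real.rpow_sub_one hpos.ne']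
  simp [EuclideanSpace.inner_single_right, pd]
  field_simp

/-- The square root of the density of `‖·‖²_{H¹_*}` without polynomial weight. -/
def starDensity (γ : ℝ) (F : V3 → ℝ) (v : V3) : ℝ :=
  √(jap v ^ γ * F v ^ 2 + jap v ^ γ * ‖anisoGrad F v‖ ^ 2)

lemma norm_anisoVec_le (v ξ : V3) : ‖anisoVec v ξ‖ ≤ jap v * ‖ξ‖ := by
  have hv := jap_pos v
  have h : ‖ξ‖ ^ 2 = ‖Pv v ξ‖ ^ 2 + ‖ξ - Pv v ξ‖ ^ 2 := by
    have := norm_add_sq_real (Pv v ξ) (ξ - Pv v ξ)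
    rw [inner_Pv_sub_Pv, add_sub_cancel] at this
    linarith
  refine abs_le_of_sq_le_sq' ?_ (by positivity) |>.2
  rw [norm_anisoVec_sq, mul_pow, h]
  have : 1 ≤ jap v ^ 2 := one_le_pow₀ (one_le_jap v)
  nlinarith [sq_nonneg ‖Pv v ξ‖]

lemma measurable_anisoGrad (F : SchwartzMap V3 ℝ) : Measurable (anisoGrad F) := by
  have hg := (continuous_gradient F).measurable
  have hP : Measurable fun v => Pv v (gradient F v) := by
    simp_rw [Pv_eq]
    exact ((measurable_id.inner hg).div (measurable_norm.pow_const 2)).smul measurable_id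
  have hj : Measurable jap := by
    unfold jap
    fun_prop
  exact hP.add (hj.smul (hg.sub hP))

lemma integrable_jap_rpow_mul_sq {γ : ℝ} (hγ : γ ≤ 0) (F : SchwartzMap V3 ℝ) :
    Integrable fun v => jap v ^ γ * F v ^ 2 := by
  refine (integrable_sq F).mono'
    ((continuous_jap_rpow γ).mul (F.continuous.pow 2)).aestronglyMeasurable
    (.of_forall fun v => ?_)
  have hv := jap_pos v
  rw [Real.norm_of_nonneg (by positivity)]
  exact mul_le_of_le_one_left (sq_nonneg _) (Real.rpow_le_one_of_one_le_of_nonpos (one_le_jap v) hγ)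

lemma integrable_jap_rpow_mul_anisoGrad_sq {γ : ℝ} (hγ : γ ≤ -2) (F : SchwartzMap V3 ℝ) :
    Integrable fun v => jap v ^ γ * ‖anisoGrad F v‖ ^ 2 := by
  refine (integrable_norm_gradient_sq F).mono' ((continuous_jap_rpow γ).measurable.mul
    ((measurable_anisoGrad F).norm.pow_const 2)).aestronglyMeasurable (.of_forall fun v => ?_)
  have hv := jap_pos v
  rw [Real.norm_of_nonneg (by positivity)]
  have h1 : jap v ^ γ * jap v ^ 2 ≤ 1 := by
    rw [← Real.rpow_natCast (jap v) 2, ← Real.rpow_add hv]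
    exact Real.rpow_le_one_of_one_le_of_nonpos (one_le_jap v) (by push_cast; linarith)
  calc jap v ^ γ * ‖anisoGrad F v‖ ^ 2 ≤ jap v ^ γ * (jap v * ‖gradient F v‖) ^ 2 := by
        gcongr
        exact norm_anisoVec_le v _
    _ = jap v ^ γ * jap v ^ 2 * ‖gradient F v‖ ^ 2 := by ring
    _ ≤ _ := mul_le_of_le_one_left (sq_nonneg _) h1

lemma starDensity_sq (γ : ℝ) (F : V3 → ℝ) (v : V3) :
    starDensity γ F v ^ 2 = jap v ^ γ * F v ^ 2 + jap v ^ γ * ‖anisoGrad F v‖ ^ 2 := by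
  have hv := jap_pos v
  exact Real.sq_sqrt (by positivity)

lemma memLp_starDensity {γ : ℝ} (hγ : γ ≤ -2) (F : SchwartzMap V3 ℝ) :
    MemLp (starDensity γ F) 2 := by
  have hm : Measurable (starDensity γ F) :=
    (((continuous_jap_rpow γ).measurable.mul (F.continuous.measurable.pow_const 2)).add
      ((continuous_jap_rpow γ).measurable.mul
        ((measurable_anisoGrad F).norm.pow_const 2))).sqrt
  rw [memLp_two_iff_integrable_sq hm.aestronglyMeasurable]
  simp_rw [starDensity_sq]
  exact (integrable_jap_rpow_mul_sq (by linarith) F).add (integrable_jap_rpow_mul_anisoGrad_sq hγ F)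

lemma coe_weighted (r : ℝ) (f : SchwartzMap V3 ℝ) :
    (weighted r f : V3 → ℝ) = fun v => jap v ^ r * f v :=
  funext fun v => weighted_apply r f v

lemma sqrt_integral_starDensity_sq {γ : ℝ} (hγ : γ ≤ -2) (k : ℝ) (g : SchwartzMap V3 ℝ) :
    √(∫ v, starDensity γ (weighted k g) v ^ 2) = H1starNorm γ k g := by
  simp_rw [starDensity_sq]
  rw [integral_add (integrable_jap_rpow_mul_sq (by linarith) _)
    (integrable_jap_rpow_mul_anisoGrad_sq hγ _), coe_weighted]
  rfl

lemma jap_rpow_half_mul_norm_anisoVec_le (γ : ℝ) {k : ℝ} (hk : 0 ≤ k) (F : V3 → ℝ) (v : V3) {c : ℝ}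
    (hc : |c| ≤ k / jap v ^ 2 * |F v|) :
    jap v ^ (γ / 2) * ‖anisoVec v (gradient F v + c • v)‖ ≤ (1 + k) * starDensity γ F v := by
  have hv := jap_pos v
  have hsq : (jap v ^ (γ / 2)) ^ 2 = jap v ^ γ := by
    rw [rpow_sq_eq hv.le]
    congr 1
    ring
  have hcv : ‖c • v‖ ≤ k * |F v| := by
    rw [norm_smul, Real.norm_eq_abs]
    have h1 : ‖v‖ ≤ jap v ^ 2 := by nlinarith [norm_le_jap v, one_le_jap v]
    calc |c| * ‖v‖ ≤ k / jap v ^ 2 * |F v| * jap v ^ 2 := by gcongr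
      _ = _ := by field_simp
  have h1 : jap v ^ (γ / 2) * |F v| ≤ starDensity γ F v := by
    refine Real.le_sqrt_of_sq_le ?_
    rw [mul_pow, sq_abs, hsq]
    exact le_add_of_nonneg_right (by positivity)
  have h2 : jap v ^ (γ / 2) * ‖anisoGrad F v‖ ≤ starDensity γ F v := by
    refine Real.le_sqrt_of_sq_le ?_
    rw [mul_pow, hsq]
    exact le_add_of_nonneg_left (by positivity)
  rw [anisoVec_add_smul_self]
  calc jap v ^ (γ / 2) * ‖anisoVec v (gradient F v) + c • v‖
      ≤ jap v ^ (γ / 2) * (‖anisoGrad F v‖ + k * |F v|) := by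
        gcongr
        exact (norm_add_le _ _).trans (add_le_add le_rfl hcv)
    _ = jap v ^ (γ / 2) * ‖anisoGrad F v‖ + k * (jap v ^ (γ / 2) * |F v|) := by ring
    _ ≤ starDensity γ F v + k * starDensity γ F v := by gcongr
    _ = _ := by ring

lemma sum_landau_flux_mul_eq (k : ℝ) (A : Fin 3 → Fin 3 → ℝ) (B : Fin 3 → ℝ)
    (g h : SchwartzMap V3 ℝ) (v : V3) :
    ∑ j, ((∑ i, A i j * pd i g v) - B j * g v) * pd j (fun w => h w * (jap w ^ k) ^ 2) v =
      (∑ j, ∑ i, A i j *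
        (gradient (weighted k g) v + (-(k / jap v ^ 2 * weighted k g v)) • v) i *
        (gradient (weighted k h) v + (k / jap v ^ 2 * weighted k h v) • v) j) -
      weighted k g v * ∑ j, B j *
        (gradient (weighted k h) v + (k / jap v ^ 2 * weighted k h v) • v) j := by
  have e1 : ∀ i, (gradient (weighted k g) v + (-(k / jap v ^ 2 * weighted k g v)) • v) i =
      jap v ^ k * pd i g v := fun i => by
    simp only [PiLp.add_apply, PiLp.smul_apply, smul_eq_mul, gradient_apply_eq_pd]
    rw [coe_weighted, pd_jap_rpow_mul k g.differentiableAt]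
    ring
  have e2 : ∀ j, jap v ^ k *
      (gradient (weighted k h) v + (k / jap v ^ 2 * weighted k h v) • v) j =
      pd j (fun w => h w * (jap w ^ k) ^ 2) v := fun j => by
    have e : (fun w => h w * (jap w ^ k) ^ 2) = fun w => jap w ^ k * weighted k h w := by
      ext w
      rw [weighted_apply]
      ring
    rw [e, pd_jap_rpow_mul k (weighted k h).differentiableAt]
    simp only [PiLp.add_apply, PiLp.smul_apply, smul_eq_mul, gradient_apply_eq_pd]
    ring
  simp_rw [e1, ← e2, weighted_apply k g]
  rw [Finset.mul_sum, ← Finset.sum_sub_distrib]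
  refine Finset.sum_congr rfl fun j _ => ?_
  rw [sub_mul, Finset.sum_mul]
  congr 1
  · exact Finset.sum_congr rfl fun i _ => by ring
  · ring


/-- Lemma 4.3: the main nonlinear estimate on the Landau collision operator,
for polynomial weights m = ⟨v⟩^k, k ≥ 0, θ > 7/2 = 2 + 3/2, θ' > 9/4. -/
theorem stmt17 (γ k θ θ' : ℝ) (hγ : γ ∈ Set.Ico (-3 : ℝ) (-2)) (hk : 0 ≤ k)
    (hθ : 7 / 2 < θ) (hθ' : 9 / 4 < θ') :
    ∃ C > (0 : ℝ), ∀ f g h : SchwartzMap V3 ℝ,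
      -(∫ v : V3, ∑ j,
          ((∑ i, conv3 (fun z => aker γ z i j) (⇑f) v * pd i (⇑g) v)
            - conv3 (fun z => bker γ z j) (⇑f) v * g v)
          * pd j (fun w => h w * (jap w ^ k) ^ 2) v)
        ≤ C * (L2wNorm θ (⇑f) * H1starNorm γ k (⇑g)
            + H1Norm (fun v => jap v ^ θ' * f v) * L2wNorm k (⇑g))
          * H1starNorm γ k (⇑h) := by
  obtain ⟨C₁, hC₁, h₁⟩ := exists_abs_sum_conv_aker_le hγ hθ
  obtain ⟨C₂, hC₂, h₂⟩ := exists_abs_sum_conv_bker_le hγ hθ'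
  have hγ2 : γ ≤ -2 := hγ.2.le
  refine ⟨C₁ * (1 + k) ^ 2 + C₂ * (1 + k), by positivity, fun f g h => ?_⟩
  set L := L2wNorm θ f with hL
  set M := H1Norm (fun v => jap v ^ θ' * f v) with hM
  have hL0 : 0 ≤ L := Real.sqrt_nonneg _
  have hM0 : 0 ≤ M := Real.sqrt_nonneg _
  set G := weighted k g with hG
  set H := weighted k h with hH
  have mG := memLp_starDensity hγ2 G
  have mH := memLp_starDensity hγ2 H
  have i₁ := (mG.integrable_mul mH).abs
  have i₂ := ((G.memLp 2 volume).integrable_mul mH).abs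
  have c₁ := integral_abs_mul_le_sqrt mG mH
  have c₂ := integral_abs_mul_le_sqrt (G.memLp 2 volume) mH
  have eG : √(∫ v, G v ^ 2) = L2wNorm k g := by
    rw [hG, coe_weighted]
    rfl
  have hs : ∀ F v, |starDensity γ F v| = starDensity γ F v := fun F v =>
    abs_of_nonneg (Real.sqrt_nonneg _)
  rw [hG, hH, sqrt_integral_starDensity_sq hγ2, sqrt_integral_starDensity_sq hγ2,
    ← hG, ← hH] at c₁
  rw [eG, hH, sqrt_integral_starDensity_sq hγ2, ← hH] at c₂
  simp only [Pi.mul_apply, abs_mul, hs] at i₁ i₂ c₁ c₂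
  have hN : 0 ≤ H1starNorm γ k g := Real.sqrt_nonneg _
  have hN' : 0 ≤ H1starNorm γ k h := Real.sqrt_nonneg _
  have hN'' : 0 ≤ L2wNorm k g := Real.sqrt_nonneg _
  refine (neg_le_abs _).trans ?_
  rw [← Real.norm_eq_abs]
  refine (norm_integral_le_of_norm_le ((i₁.const_mul (C₁ * (1 + k) ^ 2 * L)).add
    (i₂.const_mul (C₂ * (1 + k) * M))) (.of_forall fun v => ?_)).trans ?_
  · have hv := jap_pos v
    rw [sum_landau_flux_mul_eq k (fun i j => conv3 (fun z => aker γ z i j) f v)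
      (fun j => conv3 (fun z => bker γ z j) f v), ← hG, ← hH, Real.norm_eq_abs]
    set X := gradient G v + (-(k / jap v ^ 2 * G v)) • v
    set Y := gradient H v + (k / jap v ^ 2 * H v) • v
    have bX : jap v ^ (γ / 2) * ‖anisoVec v X‖ ≤ (1 + k) * starDensity γ G v :=
      jap_rpow_half_mul_norm_anisoVec_le γ hk G v
        (by rw [abs_neg, abs_mul, abs_of_nonneg (by positivity : 0 ≤ k / jap v ^ 2)])
    have bY : jap v ^ (γ / 2) * ‖anisoVec v Y‖ ≤ (1 + k) * starDensity γ H v :=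
      jap_rpow_half_mul_norm_anisoVec_le γ hk H v
        (by rw [abs_mul, abs_of_nonneg (by positivity : 0 ≤ k / jap v ^ 2)])
    have hsq : jap v ^ γ = jap v ^ (γ / 2) * jap v ^ (γ / 2) := by
      rw [← Real.rpow_add hv, add_halves]
    refine (abs_sub _ _).trans (add_le_add ?_ ?_)
    · calc _ ≤ C₁ * L * jap v ^ γ * ‖anisoVec v X‖ * ‖anisoVec v Y‖ := h₁ f v X Y
        _ = C₁ * L * ((jap v ^ (γ / 2) * ‖anisoVec v X‖) *
            (jap v ^ (γ / 2) * ‖anisoVec v Y‖)) := by rw [hsq]; ring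
        _ ≤ C₁ * L * (((1 + k) * starDensity γ G v) * ((1 + k) * starDensity γ H v)) := by
          gcongr
          exact (by positivity : (0 : ℝ) ≤ _).trans bX
        _ = _ := by ring
    · have h₂' := h₂ f v Y
      rw [coe_weighted, ← hM] at h₂'
      rw [abs_mul]
      calc _ ≤ |G v| * (C₂ * M * jap v ^ (γ / 2) * ‖anisoVec v Y‖) := by
            gcongr
            exact h₂'.trans (by gcongr; exact norm_le_anisoVec v Y)
        _ = C₂ * M * |G v| * (jap v ^ (γ / 2) * ‖anisoVec v Y‖) := by ring
        _ ≤ C₂ * M * |G v| * ((1 + k) * starDensity γ H v) := by gcongr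
        _ = _ := by ring
  · simp only [Pi.add_apply]
    rw [integral_add (i₁.const_mul _) (i₂.const_mul _), integral_const_mul, integral_const_mul]
    calc _ ≤ C₁ * (1 + k) ^ 2 * L * (H1starNorm γ k g * H1starNorm γ k h) +
          C₂ * (1 + k) * M * (L2wNorm k g * H1starNorm γ k h) := by gcongr
      _ ≤ C₁ * (1 + k) ^ 2 * L * (H1starNorm γ k g * H1starNorm γ k h) +
          C₂ * (1 + k) * M * (L2wNorm k g * H1starNorm γ k h) +
          (C₂ * (1 + k) * L * (H1starNorm γ k g * H1starNorm γ k h) +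
          C₁ * (1 + k) ^ 2 * M * (L2wNorm k g * H1starNorm γ k h)) :=
        le_add_of_nonneg_right (by positivity)
      _ = _ := by ring
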